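/- For every n ≥ 1 and every partition λ with at most n parts, there exists a polynomial Q ∈ ℂ[z₁,…,z_n], symmetric under all permutations of z₁,…,z_n, such that Z_λ(z₁,…,z_n; t₁,…,t_n) = Q(z₁,…,z_n) · ∏_{1≤i<j≤n} (t_i z_j + z_i) holds identically in z₁,…,z_n, t₁,…,t_n. In particular, ∏_{1≤i<j≤n}(t_i z_j + z_i) divides Z_λ in ℂ[z₁,…,z_n,t₁,…,t_n] and the quotient is independent of t₁,…,t_n. -/

import Mathlib

open Finset

noncomputable section

/-- The sum `d_k(𝔗)` of the `k`-th row (0-indexed) of the triangular array `T`;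
entries outside the triangle vanish, so summing over `range n` suffices. -/
def rowSum (n : ℕ) (T : ℕ → ℕ → ℤ) (k : ℕ) : ℤ := ∑ j ∈ Finset.range n, T k j

/-- `T` encodes a strict Gelfand–Tsetlin pattern with `n` rows (rows `0,…,n−1`, row `k`
having entries in columns `k,…,n−1`) with top row `T 0 j = λ_j + (n − 1 − j)`, where all
values outside the triangle are `0`. The conditions are: interleaving
`T k (j−1) ≥ T (k+1) j ≥ T k j` and strict decrease along each row. -/
def IsGT (n : ℕ) (lam : ℕ → ℕ) (T : ℕ → ℕ → ℤ) : Prop :=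
  (∀ k j : ℕ, ¬(k ≤ j ∧ j < n) → T k j = 0) ∧
  (∀ j : ℕ, j < n → T 0 j = (lam j : ℤ) + (n : ℤ) - 1 - (j : ℤ)) ∧
  (∀ k j : ℕ, k + 1 ≤ j → j < n →
    T k (j - 1) ≥ T (k + 1) j ∧ T (k + 1) j ≥ T k j) ∧
  (∀ k j : ℕ, k ≤ j → j + 1 < n → T k j > T k (j + 1))

/-- The total number of left-leaning entries of the pattern:
entries `T k j` (`1 ≤ k ≤ j < n`) with `T k j = T (k−1) (j−1)`. -/
def leftCount (n : ℕ) (T : ℕ → ℕ → ℤ) : ℕ :=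
  ((Finset.range n ×ˢ Finset.range n).filter
    (fun p => 1 ≤ p.1 ∧ p.1 ≤ p.2 ∧ T p.1 p.2 = T (p.1 - 1) (p.2 - 1))).card

/-- The total number of special entries of the pattern:
entries `T k j` (`1 ≤ k ≤ j < n`) that are neither left- nor right-leaning. -/
def specialCount (n : ℕ) (T : ℕ → ℕ → ℤ) : ℕ :=
  ((Finset.range n ×ˢ Finset.range n).filter
    (fun p => 1 ≤ p.1 ∧ p.1 ≤ p.2 ∧ T p.1 p.2 ≠ T (p.1 - 1) (p.2 - 1)
      ∧ T p.1 p.2 ≠ T (p.1 - 1) p.2)).card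

/-- The number `l_r(𝔗)` of left-leaning entries in row `r` (0-indexed, `r ≥ 1`). -/
def leftRow (n r : ℕ) (T : ℕ → ℕ → ℤ) : ℕ :=
  ((Finset.range n).filter
    (fun j => r ≤ j ∧ T r j = T (r - 1) (j - 1))).card

/-- The number `s_r(𝔗)` of special entries in row `r` (0-indexed, `r ≥ 1`). -/
def specialRow (n r : ℕ) (T : ℕ → ℕ → ℤ) : ℕ :=
  ((Finset.range n).filter
    (fun j => r ≤ j ∧ T r j ≠ T (r - 1) (j - 1) ∧ T r j ≠ T (r - 1) j)).card

/-- The partition function `Z_λ(z₁,…,z_n; t₁,…,t_n)` of the Gamma ice model, written as a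
sum over strict Gelfand–Tsetlin patterns with top row `λ + ρ`. -/
def Zice (n : ℕ) (lam : ℕ → ℕ) (z t : ℕ → ℂ) : ℂ :=
  ∑ᶠ (T : ℕ → ℕ → ℤ) (_ : IsGT n lam T),
    (∏ k ∈ Finset.range n, z k ^ (rowSum n T k - rowSum n T (k + 1))) *
      ∏ k ∈ Finset.range (n - 1),
        (t k ^ leftRow n (k + 1) T * (t k + 1) ^ specialRow n (k + 1) T)

/-- The Boltzmann weight of an entry `c` lying weakly between the neighbours `b < a` of the row
above: `t` if `c = a`, `1` if `c = b` and `t + 1` otherwise. -/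
def entryWeight {R : Type*} [CommRing R] (t : R) (a b c : ℕ) : R :=
  (if c = a then 0 else 1) + (if c = b then 0 else t)

/-- The alternant `det (y_i ^ μ_j)`. -/
def alternant {R : Type*} [CommRing R] {m : ℕ} (y : Fin m → R) (μ : Fin m → ℕ) : R :=
  (Matrix.of fun i j => y i ^ μ j).det

/-- The Vandermonde product `∏_{i<j} (y_i - y_j)`. -/
def vandermondeProd {R : Type*} [CommRing R] {m : ℕ} (y : Fin m → R) : R :=
  ∏ i, ∏ j ∈ Ioi i, (y i - y j)

/-- The sequences interleaving `μ`. -/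
def interleaving {m : ℕ} (μ : Fin (m + 1) → ℕ) : Finset (Fin m → ℕ) :=
  Fintype.piFinset fun j => Icc (μ j.succ) (μ j.castSucc)

section Algebra

variable {R : Type*} [CommRing R]

lemma sum_entryWeight (t x y : R) {a b : ℕ} (h : b < a) :
    ∑ c ∈ Icc b a, entryWeight t a b c * x ^ (a - c) * y ^ c
      = (t * y + x) * ∑ c ∈ Ico b a, y ^ c * x ^ (a - 1 - c) := by
  have h1 : ∑ c ∈ Icc b a, (if c = a then 0 else 1) * x ^ (a - c) * y ^ c
      = x * ∑ c ∈ Ico b a, y ^ c * x ^ (a - 1 - c) := by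
    rw [← Finset.Ico_insert_right h.le, sum_insert (by simp), mul_sum]
    simp only [if_true, zero_mul, zero_add]
    refine sum_congr rfl fun c hc => ?_
    rw [mem_Ico] at hc
    rw [if_neg hc.2.ne, show a - c = a - 1 - c + 1 by omega]
    ring
  have h2 : ∑ c ∈ Icc b a, (if c = b then 0 else t) * x ^ (a - c) * y ^ c
      = t * y * ∑ c ∈ Ico b a, y ^ c * x ^ (a - 1 - c) := by
    rw [← Finset.Ioc_insert_left h.le, sum_insert (by simp), mul_sum]
    simp only [if_true, zero_mul, zero_add]
    have : Ioc b a = Ico (b + 1) (a + 1) := by ext; simp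
    rw [this, ← sum_Ico_add' _ b a 1]
    refine sum_congr rfl fun c hc => ?_
    rw [mem_Ico] at hc
    rw [if_neg (show c + 1 ≠ b by omega), show a - (c + 1) = a - 1 - c by omega]
    ring
  simp only [entryWeight, add_mul, sum_add_distrib, h1, h2]
  ring

lemma det_sum_columns {m : ℕ} (y : Fin m → R) (s : Fin m → Finset ℕ) (f : Fin m → ℕ → R) :
    (Matrix.of fun i j => ∑ c ∈ s j, f j c * y i ^ c).det
      = ∑ ν ∈ Fintype.piFinset s, (∏ j, f j (ν j)) * alternant y ν := by
  simp only [alternant, Matrix.det_apply, Matrix.of_apply, prod_univ_sum, mul_sum, smul_sum]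
  rw [sum_comm]
  refine sum_congr rfl fun ν _ => sum_congr rfl fun σ _ => ?_
  rw [prod_mul_distrib, mul_smul_comm]

lemma alternant_cons {m : ℕ} (x : R) (y : Fin m → R) {μ : Fin (m + 1) → ℕ} (hμ : Antitone μ) :
    alternant (Fin.cons x y : Fin (m + 1) → R) μ
      = x ^ μ (Fin.last m) *
        (Matrix.of fun i j : Fin m =>
          x ^ (μ j.castSucc - μ j.succ) * y i ^ μ j.succ - y i ^ μ j.castSucc).det := by
  set z : Fin (m + 1) → R := Fin.cons x y
  set A : Matrix (Fin (m + 1)) (Fin (m + 1)) R := Matrix.of fun i j => z i ^ μ j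
  set C : Matrix (Fin (m + 1)) (Fin (m + 1)) R := Matrix.of fun i =>
    (Fin.snoc (fun j : Fin m => z i ^ μ j.castSucc
      - x ^ (μ j.castSucc - μ j.succ) * z i ^ μ j.succ) (z i ^ μ (Fin.last m)) : Fin (m + 1) → R)
    with hC
  have hAC : A.det = C.det := by
    rw [← Matrix.det_submatrix_equiv_self Fin.revPerm A,
      ← Matrix.det_submatrix_equiv_self Fin.revPerm C]
    refine Matrix.det_eq_of_forall_col_eq_smul_add_pred
      (fun j => x ^ (μ j.rev.castSucc - μ j.rev.succ)) (fun i => ?_) (fun i j => ?_)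
    · simp [A, C, Fin.rev_zero]
    · simp [A, C, Fin.rev_succ, Fin.rev_castSucc]
  have hrow (j : Fin m) : C 0 j.castSucc = 0 := by
    simp only [hC, Matrix.of_apply, Fin.snoc_castSucc, z, Fin.cons_zero, ← pow_add]
    rw [Nat.sub_add_cancel (hμ (Fin.castSucc_lt_succ).le), sub_self]
  have hminor : C.submatrix Fin.succ (Fin.last m).succAbove
      = -(Matrix.of fun i j : Fin m =>
          x ^ (μ j.castSucc - μ j.succ) * y i ^ μ j.succ - y i ^ μ j.castSucc) := by
    ext i j
    simp [hC, z]
  have hlast : C 0 (Fin.last m) = x ^ μ (Fin.last m) := by simp [hC, z]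
  rw [alternant, hAC, Matrix.det_succ_row_zero, Fin.sum_univ_castSucc]
  simp only [hrow, mul_zero, zero_mul, sum_const_zero, zero_add, hminor, hlast, Matrix.det_neg,
    Fintype.card_fin, Fin.val_last]
  have : ((-1 : R) ^ m) * (-1) ^ m = 1 := by rw [← mul_pow]; simp
  linear_combination (x ^ μ (Fin.last m) * (Matrix.of fun i j : Fin m =>
          x ^ (μ j.castSucc - μ j.succ) * y i ^ μ j.succ - y i ^ μ j.castSucc).det) * this

/-- The branching rule for alternants deformed by `t`. -/
lemma sum_interleaving_alternant {m : ℕ} (t x : R) (y : Fin m → R) {μ : Fin (m + 1) → ℕ}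
    (hμ : StrictAnti μ) :
    (∏ i, (x - y i)) * ∑ ν ∈ interleaving μ, x ^ (∑ j, μ j - ∑ j, ν j) *
        (∏ j, entryWeight t (μ j.castSucc) (μ j.succ) (ν j)) * alternant y ν
      = (∏ i, (t * y i + x)) * alternant (Fin.cons x y : Fin (m + 1) → R) μ := by
  have hexp : ∀ ν ∈ interleaving μ, x ^ (∑ j, μ j - ∑ j, ν j)
      = x ^ μ (Fin.last m) * ∏ j, x ^ (μ j.castSucc - ν j) := by
    intro ν hν
    have hle : ∀ j ∈ univ, ν j ≤ μ j.castSucc := fun j _ =>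
      (mem_Icc.1 (Fintype.mem_piFinset.1 hν j)).2
    rw [prod_pow_eq_pow_sum, ← pow_add, sum_tsub_distrib _ hle, Fin.sum_univ_castSucc]
    congr 1
    have := sum_le_sum hle
    omega
  have hsum : ∑ ν ∈ interleaving μ, x ^ (∑ j, μ j - ∑ j, ν j) *
        (∏ j, entryWeight t (μ j.castSucc) (μ j.succ) (ν j)) * alternant y ν
      = x ^ μ (Fin.last m) * (∏ i, (t * y i + x)) * (Matrix.of fun i j : Fin m =>
          ∑ c ∈ Ico (μ j.succ) (μ j.castSucc), y i ^ c * x ^ (μ j.castSucc - 1 - c)).det := by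
    rw [mul_assoc, ← Matrix.det_mul_column]
    simp only [Matrix.of_apply, ← sum_entryWeight t x _ (hμ (Fin.castSucc_lt_succ))]
    rw [det_sum_columns, mul_sum]
    refine sum_congr rfl fun ν hν => ?_
    rw [hexp ν hν, prod_mul_distrib]
    ring
  have hdet : (∏ i, (x - y i)) * (Matrix.of fun i j : Fin m =>
          ∑ c ∈ Ico (μ j.succ) (μ j.castSucc), y i ^ c * x ^ (μ j.castSucc - 1 - c)).det
      = (Matrix.of fun i j : Fin m =>
          x ^ (μ j.castSucc - μ j.succ) * y i ^ μ j.succ - y i ^ μ j.castSucc).det := by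
    rw [← Matrix.det_mul_column]
    congr 1
    ext i j
    simp only [Matrix.of_apply]
    linear_combination -mul_geom_sum₂_Ico (y i) x (hμ (Fin.castSucc_lt_succ (i := j))).le
  rw [hsum, alternant_cons x y hμ.antitone, ← hdet]
  ring

lemma vandermondeProd_cons {m : ℕ} (x : R) (y : Fin m → R) :
    vandermondeProd (Fin.cons x y : Fin (m + 1) → R) = (∏ i, (x - y i)) * vandermondeProd y := by
  simp only [vandermondeProd, Fin.prod_univ_succ, Fin.cons_zero, Fin.cons_succ]
  simp [Fin.Ioi_zero_eq_map, -Fin.map_succEmb_Ioi]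

lemma vandermondeProd_dvd_det {m : ℕ} (y : Fin m → R) (p : Fin m → Polynomial R) :
    vandermondeProd y ∣ (Matrix.of fun i j => (p j).eval (y i)).det := by
  induction m with
  | zero => simp [vandermondeProd]
  | succ m ih =>
    obtain ⟨x, y, rfl⟩ : ∃ x y', y = Fin.cons x y' := ⟨y 0, Fin.tail y, (Fin.cons_self_tail y).symm⟩
    have hq (j : Fin (m + 1)) : ∃ q : Polynomial R, ∀ i,
        (p j).eval (y i) - (p j).eval x = (x - y i) * q.eval (y i) := by
      obtain ⟨q, hq⟩ := Polynomial.X_sub_C_dvd_sub_C_eval (p := p j) (a := x)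
      refine ⟨-q, fun i => ?_⟩
      have := congrArg (Polynomial.eval (y i)) hq
      simp only [Polynomial.eval_sub, Polynomial.eval_C, Polynomial.eval_mul,
        Polynomial.eval_X] at this
      rw [this, Polynomial.eval_neg]
      ring
    choose q hq using hq
    set z : Fin (m + 1) → R := Fin.cons x y
    have hdet : (Matrix.of fun i j => (p j).eval (z i)).det
        = (Matrix.of (Fin.cons (fun j => (p j).eval x)
          (fun i j => (x - y i) * (q j).eval (y i))) :
            Matrix (Fin (m + 1)) (Fin (m + 1)) R).det := by
      refine Matrix.det_eq_of_forall_row_eq_smul_add_const (Fin.cons 0 fun _ => 1) 0 rfl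
        fun i j => ?_
      refine Fin.cases ?_ (fun i => ?_) i
      · simp [z]
      · simp [z, ← hq]
    rw [hdet, vandermondeProd_cons, Matrix.det_succ_row_zero]
    refine dvd_sum fun k _ => Dvd.dvd.mul_left ?_ _
    have : (Matrix.of (Fin.cons (fun j => (p j).eval x)
          (fun i j => (x - y i) * (q j).eval (y i))) :
            Matrix (Fin (m + 1)) (Fin (m + 1)) R).submatrix Fin.succ k.succAbove
        = Matrix.of fun i j => (x - y i) *
          (Matrix.of fun i j => (q (k.succAbove j)).eval (y i)) i j := by
      ext i j
      simp
    rw [this, Matrix.det_mul_column]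
    exact mul_dvd_mul_left _ (ih y _)

lemma vandermondeProd_dvd_alternant {m : ℕ} (y : Fin m → R) (μ : Fin m → ℕ) :
    vandermondeProd y ∣ alternant y μ := by
  simpa [alternant] using vandermondeProd_dvd_det y fun j => Polynomial.X ^ μ j

lemma alternant_comp_perm {m : ℕ} (y : Fin m → R) (μ : Fin m → ℕ) (σ : Equiv.Perm (Fin m)) :
    alternant (y ∘ σ) μ = Equiv.Perm.sign σ * alternant y μ := by
  rw [alternant, alternant, ← Matrix.det_permute]
  rfl

lemma vandermondeProd_comp_perm {m : ℕ} (y : Fin m → R) (σ : Equiv.Perm (Fin m)) :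
    vandermondeProd (y ∘ σ) = Equiv.Perm.sign σ * vandermondeProd y := by
  have h (w : Fin m → R) : vandermondeProd w = alternant w fun j => (j.rev : ℕ) := by
    have := Matrix.det_projVandermonde (1 : Fin m → R) w
    simp only [Pi.one_apply, one_mul] at this
    rw [vandermondeProd, ← this, alternant]
    congr 1
    ext i j
    simp [Matrix.projVandermonde_apply]
  rw [h, h, alternant_comp_perm]

lemma vandermondeProd_ne_zero [IsDomain R] {m : ℕ} {y : Fin m → R} (hy : Function.Injective y) :
    vandermondeProd y ≠ 0 :=
  prod_ne_zero_iff.2 fun _ _ => prod_ne_zero_iff.2 fun _ hj =>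
    sub_ne_zero.2 (hy.ne (mem_Ioi.1 hj).ne)

lemma alternant_eq_zero {m : ℕ} (y : Fin m → R) {ν : Fin m → ℕ} (hν : ¬ Function.Injective ν) :
    alternant y ν = 0 := by
  simp only [Function.Injective, not_forall] at hν
  obtain ⟨i, j, hij, hne⟩ := hν
  exact Matrix.det_zero_of_column_eq hne fun k => by simp [hij]

lemma map_vandermondeProd {S : Type*} [CommRing S] (φ : R →+* S) {m : ℕ} (y : Fin m → R) :
    φ (vandermondeProd y) = vandermondeProd (φ ∘ y) := by
  simp [vandermondeProd]

lemma map_alternant {S : Type*} [CommRing S] (φ : R →+* S) {m : ℕ} (y : Fin m → R)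
    (μ : Fin m → ℕ) : φ (alternant y μ) = alternant (φ ∘ y) μ := by
  rw [alternant, RingHom.map_det, alternant]
  congr 1
  ext i j
  simp

lemma exists_symmetric_quotient {K : Type*} [CommRing K] [IsDomain K] {m : ℕ} (μ : Fin m → ℕ) :
    ∃ Q : MvPolynomial (Fin m) K, Q.IsSymmetric ∧
      alternant MvPolynomial.X μ = vandermondeProd MvPolynomial.X * Q := by
  obtain ⟨Q, hQ⟩ := vandermondeProd_dvd_alternant
    (MvPolynomial.X : Fin m → MvPolynomial (Fin m) K) μ
  refine ⟨Q, fun σ => ?_, hQ⟩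
  have hcomp : (MvPolynomial.rename σ : MvPolynomial (Fin m) K →ₐ[K] _).toRingHom
      ∘ (MvPolynomial.X : Fin m → MvPolynomial (Fin m) K) = MvPolynomial.X ∘ σ := by
    ext1 i
    simp
  have h := congrArg (MvPolynomial.rename σ : MvPolynomial (Fin m) K →ₐ[K] _).toRingHom hQ
  rw [map_mul, map_alternant, map_vandermondeProd, hcomp, alternant_comp_perm,
    vandermondeProd_comp_perm, hQ, ← mul_assoc] at h
  refine (mul_left_cancel₀ (mul_ne_zero ?_
    (vandermondeProd_ne_zero (MvPolynomial.X_injective (R := K) (σ := Fin m)))) h).symm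
  rcases Int.units_eq_one_or (Equiv.Perm.sign σ) with h | h <;> simp [h]

end Algebra

section Ice

/-- The partition function with top row `μ`, computed row by row. -/
def ice {R : Type*} [CommRing R] : (m : ℕ) → (Fin m → ℕ) → (ℕ → R) → (ℕ → R) → R
  | 0, _, _, _ => 1
  | m + 1, μ, z, t => ∑ ν ∈ interleaving μ with StrictAnti ν, z 0 ^ (∑ j, μ j - ∑ j, ν j) *
      (∏ j, entryWeight (t 0) (μ j.castSucc) (μ j.succ) (ν j)) *
      ice m ν (fun k => z (k + 1)) (fun k => t (k + 1))

variable {R : Type*} [CommRing R]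

lemma map_ice {S : Type*} [CommRing S] (φ : R →+* S) {m : ℕ} (μ : Fin m → ℕ) (z t : ℕ → R) :
    φ (ice m μ z t) = ice m μ (φ ∘ z) (φ ∘ t) := by
  induction m generalizing z t with
  | zero => simp [ice]
  | succ m ih =>
    simp only [ice, map_sum, map_mul, map_pow, map_prod, ih, Function.comp_def, entryWeight,
      map_add, apply_ite φ, map_zero, map_one]

lemma antitone_of_mem_interleaving {m : ℕ} {μ : Fin (m + 1) → ℕ} (hμ : Antitone μ)
    {ν : Fin m → ℕ} (hν : ν ∈ interleaving μ) : Antitone ν := by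
  have h (j) := mem_Icc.1 (Fintype.mem_piFinset.1 hν j)
  intro i j hij
  rcases hij.eq_or_lt with rfl | hij
  · rfl
  · exact ((h j).2.trans (hμ (Fin.succ_le_castSucc_iff.2 hij))).trans (h i).1

theorem vandermondeProd_mul_ice {m : ℕ} {μ : Fin m → ℕ} (hμ : StrictAnti μ) (z t : ℕ → R) :
    vandermondeProd (fun i : Fin m => z i) * ice m μ z t
      = alternant (fun i : Fin m => z i) μ *
        ∏ i ∈ range m, ∏ j ∈ Ico (i + 1) m, (t i * z j + z i) := by
  induction m generalizing z t with
  | zero => simp [vandermondeProd, ice, alternant]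
  | succ m ih =>
    set y : Fin m → R := fun i => z (i + 1)
    set P : R := ∏ i ∈ range m, ∏ j ∈ Ico (i + 1) m, (t (i + 1) * z (j + 1) + z (i + 1))
    have hz : (fun i : Fin (m + 1) => z i) = Fin.cons (z 0) y := by
      ext i
      refine Fin.cases ?_ (fun i => ?_) i <;> simp [y]
    have hP : ∏ i ∈ range (m + 1), ∏ j ∈ Ico (i + 1) (m + 1), (t i * z j + z i)
        = P * ∏ i, (t 0 * y i + z 0) := by
      rw [prod_range_succ', prod_Ico_eq_prod_range, Fin.prod_univ_eq_prod_range
        (fun i => t 0 * z (i + 1) + z 0)]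
      congr 1
      · exact prod_congr rfl fun i _ =>
          (prod_Ico_add' (fun j => t (i + 1) * z j + z (i + 1)) (i + 1) m 1).symm
      · simp [add_comm]
    have hsum : vandermondeProd y * ice (m + 1) μ z t
        = P * ∑ ν ∈ interleaving μ, z 0 ^ (∑ j, μ j - ∑ j, ν j) *
          (∏ j, entryWeight (t 0) (μ j.castSucc) (μ j.succ) (ν j)) * alternant y ν := by
      rw [ice, sum_filter, mul_sum, mul_sum]
      refine sum_congr rfl fun ν hν => ?_
      split_ifs with h
      · linear_combination (z 0 ^ (∑ j, μ j - ∑ j, ν j) *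
          (∏ j, entryWeight (t 0) (μ j.castSucc) (μ j.succ) (ν j))) *
          ih h (fun k => z (k + 1)) (fun k => t (k + 1))
      · rw [alternant_eq_zero y fun hinj => h
          ((antitone_of_mem_interleaving hμ.antitone hν).strictAnti_of_injective hinj)]
        simp
    rw [hz, hP, vandermondeProd_cons, mul_assoc, hsum]
    linear_combination P * sum_interleaving_alternant (t 0) (z 0) y hμ

theorem exists_symmetric_ice_eq {m : ℕ} {μ : Fin m → ℕ} (hμ : StrictAnti μ) :
    ∃ Q : MvPolynomial (Fin m) ℂ, Q.IsSymmetric ∧ ∀ z t : ℕ → ℂ,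
      ice m μ z t = MvPolynomial.eval (fun i : Fin m => z i) Q *
        ∏ i ∈ range m, ∏ j ∈ Ico (i + 1) m, (t i * z j + z i) := by
  obtain ⟨Q, hsymm, hQ⟩ := exists_symmetric_quotient (K := ℂ) μ
  refine ⟨Q, hsymm, fun z t => ?_⟩
  let Z : ℕ → MvPolynomial (ℕ ⊕ ℕ) ℂ := fun i => MvPolynomial.X (Sum.inl i)
  let T : ℕ → MvPolynomial (ℕ ⊕ ℕ) ℂ := fun i => MvPolynomial.X (Sum.inr i)
  let φ : MvPolynomial (Fin m) ℂ →ₐ[ℂ] MvPolynomial (ℕ ⊕ ℕ) ℂ :=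
    MvPolynomial.aeval fun i : Fin m => Z i
  have hφ : φ.toRingHom ∘ MvPolynomial.X = fun i : Fin m => Z i := by
    ext1 i
    simp [φ]
  have hA : alternant (fun i : Fin m => Z i) μ
      = vandermondeProd (fun i : Fin m => Z i) * φ Q := by
    simpa only [map_mul, map_alternant, map_vandermondeProd, hφ] using! congrArg φ.toRingHom hQ
  have hinj : Function.Injective fun i : Fin m => Z i := fun i j h =>
    Fin.ext (Sum.inl_injective (MvPolynomial.X_injective h))
  have hgen : ice m μ Z T = φ Q * ∏ i ∈ range m, ∏ j ∈ Ico (i + 1) m, (T i * Z j + Z i) := by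
    refine mul_left_cancel₀ (vandermondeProd_ne_zero hinj) ?_
    rw [vandermondeProd_mul_ice hμ, hA, mul_assoc]
  let ev : MvPolynomial (ℕ ⊕ ℕ) ℂ →+* ℂ := MvPolynomial.eval (Sum.elim z t)
  have hZ : ev ∘ Z = z := by ext1; simp [ev, Z]
  have hT : ev ∘ T = t := by ext1; simp [ev, T]
  have hev : ev (φ Q) = MvPolynomial.eval (fun i : Fin m => z i) Q := by
    have : ev.comp φ.toRingHom = MvPolynomial.eval fun i : Fin m => z i := by
      ext i <;> simp [ev, φ, Z]
    exact congrArg (fun g : MvPolynomial (Fin m) ℂ →+* ℂ => g Q) this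
  have h := congrArg ev hgen
  rw [map_ice, hZ, hT, map_mul, hev, map_prod] at h
  simpa [map_prod, ev, Z, T] using h

end Ice

section Patterns

/-- `T` encodes a strict Gelfand–Tsetlin pattern with `n` rows and top row `μ`. -/
def IsPattern (n : ℕ) (μ : Fin n → ℕ) (T : ℕ → ℕ → ℤ) : Prop :=
  (∀ k j : ℕ, ¬(k ≤ j ∧ j < n) → T k j = 0) ∧
  (∀ j : Fin n, T 0 j = μ j) ∧
  (∀ k j : ℕ, k + 1 ≤ j → j < n →
    T k (j - 1) ≥ T (k + 1) j ∧ T (k + 1) j ≥ T k j) ∧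
  (∀ k j : ℕ, k ≤ j → j + 1 < n → T k j > T k (j + 1))

/-- The array with top row `μ` and remaining rows given by `T`. -/
def addTopRow {n : ℕ} (μ : Fin n → ℕ) (T : ℕ → ℕ → ℤ) : ℕ → ℕ → ℤ
  | 0, j => if h : j < n then μ ⟨j, h⟩ else 0
  | _ + 1, 0 => 0
  | k + 1, j + 1 => T k j

open Classical in
/-- The strict Gelfand–Tsetlin patterns with strictly decreasing top row `μ`, generated row by
row. -/
def patterns : (n : ℕ) → (Fin n → ℕ) → Finset (ℕ → ℕ → ℤ)
  | 0, _ => {0}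
  | m + 1, μ => {ν ∈ interleaving μ | StrictAnti ν}.biUnion fun ν =>
      (patterns m ν).image (addTopRow μ)

/-- The Boltzmann weight of a pattern. -/
def patternWeight (n : ℕ) (T : ℕ → ℕ → ℤ) (z t : ℕ → ℂ) : ℂ :=
  (∏ k ∈ range n, z k ^ (rowSum n T k - rowSum n T (k + 1))) *
    ∏ k ∈ range n, (t k ^ leftRow n (k + 1) T * (t k + 1) ^ specialRow n (k + 1) T)

lemma addTopRow_zero {n : ℕ} (μ : Fin n → ℕ) (T : ℕ → ℕ → ℤ) (j : Fin n) :
    addTopRow μ T 0 j = μ j := by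
  simp [addTopRow]

lemma addTopRow_injective {n : ℕ} (μ : Fin n → ℕ) : Function.Injective (addTopRow μ) :=
  fun _ _ h => funext₂ fun k j => congrFun₂ h (k + 1) (j + 1)

lemma isPattern_addTopRow {m : ℕ} {μ : Fin (m + 1) → ℕ} (hμ : StrictAnti μ) {ν : Fin m → ℕ}
    (hν : ν ∈ interleaving μ) {T : ℕ → ℕ → ℤ} (hT : IsPattern m ν T) :
    IsPattern (m + 1) μ (addTopRow μ T) := by
  obtain ⟨h1, h2, h3, h4⟩ := hT
  refine ⟨?_, addTopRow_zero μ T, ?_, ?_⟩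
  · rintro (_ | k) (_ | j) h
    · simp at h
    · simp only [addTopRow]
      rw [dif_neg (by omega)]
    · rfl
    · exact h1 k j (by omega)
  · rintro (_ | k) (_ | j) hk hj
    · omega
    · have hj' : j < m := by omega
      have := mem_Icc.1 (Fintype.mem_piFinset.1 hν ⟨j, hj'⟩)
      have e1 : addTopRow μ T 0 j = μ (Fin.castSucc ⟨j, hj'⟩) :=
        addTopRow_zero μ T (Fin.castSucc ⟨j, hj'⟩)
      have e2 : addTopRow μ T 0 (j + 1) = μ (Fin.succ ⟨j, hj'⟩) :=
        addTopRow_zero μ T (Fin.succ ⟨j, hj'⟩)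
      have e3 : addTopRow μ T 1 (j + 1) = ν ⟨j, hj'⟩ := h2 ⟨j, hj'⟩
      rw [Nat.add_sub_cancel, zero_add, e1, e2, e3]
      omega
    · omega
    · obtain ⟨j, rfl⟩ : ∃ i, j = i + 1 := ⟨j - 1, by omega⟩
      exact h3 k (j + 1) (by omega) (by omega)
  · rintro (_ | k) (_ | j) hk hj
    · have := hμ (show (⟨0, by omega⟩ : Fin (m + 1)) < ⟨1, by omega⟩ from
        Fin.lt_def.2 Nat.zero_lt_one)
      simp only [addTopRow]
      rw [dif_pos (by omega), dif_pos (by omega)]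
      exact_mod_cast this
    · have := hμ (show (⟨j + 1, by omega⟩ : Fin (m + 1)) < ⟨j + 2, by omega⟩ by simp)
      simp only [addTopRow]
      rw [dif_pos (by omega), dif_pos (by omega)]
      exact_mod_cast this
    · omega
    · exact h4 k j (by omega) (by omega)

lemma IsPattern.exists_eq_addTopRow {m : ℕ} {μ : Fin (m + 1) → ℕ} {T : ℕ → ℕ → ℤ}
    (hT : IsPattern (m + 1) μ T) :
    ∃ ν ∈ interleaving μ, StrictAnti ν ∧ ∃ T', IsPattern m ν T' ∧ addTopRow μ T' = T := by
  obtain ⟨h1, h2, h3, h4⟩ := hT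
  have hinter (j : Fin m) : (μ j.castSucc : ℤ) ≥ T 1 (j + 1) ∧ T 1 (j + 1) ≥ μ j.succ := by
    rw [← h2, ← h2]
    exact h3 0 (j + 1) (by omega) (by omega)
  have hν (j : Fin m) : ((T 1 (j + 1)).toNat : ℤ) = T 1 (j + 1) :=
    Int.toNat_of_nonneg (by have := hinter j; omega)
  refine ⟨fun j => (T 1 (j + 1)).toNat, ?_, ?_, fun k j => T (k + 1) (j + 1),
    ⟨?_, fun j => (hν j).symm, ?_, ?_⟩, ?_⟩
  · refine Fintype.mem_piFinset.2 fun j => mem_Icc.2 ?_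
    have := hinter j
    omega
  · cases m with
    | zero => exact fun i => i.elim0
    | succ m =>
      refine Fin.strictAnti_iff_succ_lt.2 fun j => ?_
      have h : T 1 (j + 1) > T 1 (j + 1 + 1) := h4 1 (j + 1) (by omega) (by omega)
      have h' := hν j.succ
      rw [Fin.val_succ] at h'
      simp only [Fin.val_succ, Fin.val_castSucc]
      omega
  · exact fun k j h => h1 _ _ (by omega)
  · intro k j hk hj
    have := h3 (k + 1) (j + 1) (by omega) (by omega)
    rwa [show j + 1 - 1 = j - 1 + 1 by omega] at this
  · exact fun k j hk hj => h4 (k + 1) (j + 1) (by omega) (by omega)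
  · ext (_ | k) (_ | j)
    · exact (addTopRow_zero μ _ 0).trans (h2 0).symm
    · simp only [addTopRow]
      split_ifs with h
      · exact (h2 ⟨j + 1, h⟩).symm
      · exact (h1 _ _ (by omega)).symm
    · exact (h1 _ _ (by omega)).symm
    · rfl

lemma mem_patterns {n : ℕ} {μ : Fin n → ℕ} (hμ : StrictAnti μ) {T : ℕ → ℕ → ℤ} :
    T ∈ patterns n μ ↔ IsPattern n μ T := by
  classical
  induction n generalizing T with
  | zero =>
    simp only [patterns, mem_singleton]
    constructor
    · rintro rfl
      exact ⟨fun _ _ _ => rfl, fun j => j.elim0, fun _ _ _ h => by omega, fun _ _ _ h => by omega⟩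
    · exact fun h => funext₂ fun k j => h.1 k j (by omega)
  | succ m ih =>
    simp only [patterns, mem_biUnion, mem_filter, mem_image]
    constructor
    · rintro ⟨ν, ⟨hν, hanti⟩, T', hT', rfl⟩
      exact isPattern_addTopRow hμ hν ((ih hanti).1 hT')
    · intro h
      obtain ⟨ν, hν, hanti, T', hT', h⟩ := h.exists_eq_addTopRow
      exact ⟨ν, ⟨hν, hanti⟩, T', (ih hanti).2 hT', h⟩

lemma rowSum_addTopRow_zero {m : ℕ} (μ : Fin m → ℕ) (T : ℕ → ℕ → ℤ) :
    rowSum m (addTopRow μ T) 0 = ∑ j, (μ j : ℤ) := by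
  simp only [rowSum, Finset.sum_range, addTopRow_zero]

lemma rowSum_addTopRow_succ {m : ℕ} (μ : Fin (m + 1) → ℕ) (T : ℕ → ℕ → ℤ) (k : ℕ) :
    rowSum (m + 1) (addTopRow μ T) (k + 1) = rowSum m T k := by
  simp [rowSum, sum_range_succ', addTopRow]

lemma leftRow_addTopRow {m : ℕ} (μ : Fin (m + 1) → ℕ) (T : ℕ → ℕ → ℤ) (k : ℕ) :
    leftRow (m + 1) (k + 2) (addTopRow μ T) = leftRow m (k + 1) T := by
  simp only [leftRow, card_filter, sum_range_succ']
  rw [if_neg (by omega), add_zero]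
  refine sum_congr rfl fun j _ => if_congr ?_ rfl rfl
  cases j with
  | zero => simp
  | succ j => simp [addTopRow]

lemma specialRow_addTopRow {m : ℕ} (μ : Fin (m + 1) → ℕ) (T : ℕ → ℕ → ℤ) (k : ℕ) :
    specialRow (m + 1) (k + 2) (addTopRow μ T) = specialRow m (k + 1) T := by
  simp only [specialRow, card_filter, sum_range_succ']
  rw [if_neg (by omega), add_zero]
  refine sum_congr rfl fun j _ => if_congr ?_ rfl rfl
  cases j with
  | zero => simp
  | succ j => simp [addTopRow]

lemma addTopRow_weight {m : ℕ} {μ : Fin (m + 1) → ℕ} (hμ : StrictAnti μ) {ν : Fin m → ℕ}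
    {T : ℕ → ℕ → ℤ} (hT : IsPattern m ν T) (t : ℂ) :
    t ^ leftRow (m + 1) 1 (addTopRow μ T) * (t + 1) ^ specialRow (m + 1) 1 (addTopRow μ T)
      = ∏ j, entryWeight t (μ j.castSucc) (μ j.succ) (ν j) := by
  have e1 (j : Fin m) : addTopRow μ T 0 j = μ j.castSucc := addTopRow_zero μ T j.castSucc
  have e2 (j : Fin m) : addTopRow μ T 0 (j + 1) = μ j.succ := addTopRow_zero μ T j.succ
  have e3 (j : Fin m) : addTopRow μ T 1 (j + 1) = ν j := hT.2.1 j
  have hl : leftRow (m + 1) 1 (addTopRow μ T) = ∑ j, if ν j = μ j.castSucc then 1 else 0 := by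
    simp only [leftRow, card_filter, sum_range_succ', Finset.sum_range]
    simp [e1, e3]
  have hs : specialRow (m + 1) 1 (addTopRow μ T)
      = ∑ j, if ν j ≠ μ j.castSucc ∧ ν j ≠ μ j.succ then 1 else 0 := by
    simp only [specialRow, card_filter, sum_range_succ', Finset.sum_range]
    simp [e1, e2, e3]
  rw [hl, hs, ← prod_pow_eq_pow_sum, ← prod_pow_eq_pow_sum, ← prod_mul_distrib]
  refine prod_congr rfl fun j _ => ?_
  have := hμ (Fin.castSucc_lt_succ (i := j))
  by_cases h1 : ν j = μ j.castSucc
  · simp [entryWeight, h1, this.ne']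
  · by_cases h2 : ν j = μ j.succ
    · simp [entryWeight, h2, this.ne]
    · simp [entryWeight, h1, h2, add_comm]

lemma patternWeight_addTopRow {m : ℕ} {μ : Fin (m + 1) → ℕ} (hμ : StrictAnti μ) {ν : Fin m → ℕ}
    (hν : ν ∈ interleaving μ) {T : ℕ → ℕ → ℤ} (hT : IsPattern m ν T) (z t : ℕ → ℂ) :
    patternWeight (m + 1) (addTopRow μ T) z t
      = z 0 ^ (∑ j, μ j - ∑ j, ν j) *
          (∏ j, entryWeight (t 0) (μ j.castSucc) (μ j.succ) (ν j)) *
        patternWeight m T (fun k => z (k + 1)) (fun k => t (k + 1)) := by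
  have hle : ∑ j, ν j ≤ ∑ j, μ j := by
    rw [Fin.sum_univ_castSucc μ]
    exact (sum_le_sum fun j _ => (mem_Icc.1 (Fintype.mem_piFinset.1 hν j)).2).trans
      (Nat.le_add_right _ _)
  have hrow : rowSum m T 0 = ∑ j, (ν j : ℤ) := by
    simp only [rowSum, Finset.sum_range, hT.2.1]
  have hz : z 0 ^ (rowSum (m + 1) (addTopRow μ T) 0 - rowSum (m + 1) (addTopRow μ T) (0 + 1))
      = z 0 ^ (∑ j, μ j - ∑ j, ν j) := by
    rw [rowSum_addTopRow_zero, rowSum_addTopRow_succ, hrow, ← zpow_natCast, Nat.cast_sub hle]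
    push_cast
    rfl
  simp only [patternWeight, prod_range_succ' _ m]
  rw [hz, zero_add, addTopRow_weight hμ hT]
  simp only [rowSum_addTopRow_succ, leftRow_addTopRow, specialRow_addTopRow]
  ring

theorem sum_patternWeight {n : ℕ} {μ : Fin n → ℕ} (hμ : StrictAnti μ) (z t : ℕ → ℂ) :
    ∑ T ∈ patterns n μ, patternWeight n T z t = ice n μ z t := by
  classical
  induction n generalizing z t with
  | zero => simp [patterns, patternWeight, ice]
  | succ m ih =>
    simp only [patterns, ice]
    rw [sum_biUnion]
    · refine sum_congr rfl fun ν hν => ?_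
      obtain ⟨hν, hanti⟩ := mem_filter.1 hν
      rw [sum_image (addTopRow_injective μ).injOn, ← ih hanti, mul_sum]
      exact sum_congr rfl fun T hT =>
        patternWeight_addTopRow hμ hν ((mem_patterns hanti).1 hT) z t
    · intro ν hν ν' hν' hne
      refine disjoint_left.2 fun T hT hT' => hne ?_
      obtain ⟨S, hS, rfl⟩ := mem_image.1 hT
      obtain ⟨S', hS', h⟩ := mem_image.1 hT'
      obtain rfl := addTopRow_injective μ h
      ext j
      have h := ((mem_patterns (mem_filter.1 hν).2).1 hS).2.1 j
      rw [((mem_patterns (mem_filter.1 hν').2).1 hS').2.1 j] at h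
      exact_mod_cast h.symm

lemma patternWeight_eq {n : ℕ} (hn : 1 ≤ n) (T : ℕ → ℕ → ℤ) (z t : ℕ → ℂ) :
    patternWeight n T z t
      = (∏ k ∈ range n, z k ^ (rowSum n T k - rowSum n T (k + 1))) *
        ∏ k ∈ range (n - 1), (t k ^ leftRow n (k + 1) T * (t k + 1) ^ specialRow n (k + 1) T) := by
  obtain ⟨m, rfl⟩ : ∃ m, n = m + 1 := ⟨n - 1, by omega⟩
  have hl : leftRow (m + 1) (m + 1) T = 0 :=
    card_eq_zero.2 (filter_eq_empty_iff.2 fun j hj h => by have := mem_range.1 hj; omega)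
  have hs : specialRow (m + 1) (m + 1) T = 0 :=
    card_eq_zero.2 (filter_eq_empty_iff.2 fun j hj h => by have := mem_range.1 hj; omega)
  rw [patternWeight, prod_range_succ (fun k => _ * _) m, hl, hs]
  simp

lemma isGT_iff_isPattern {n : ℕ} {lam : ℕ → ℕ} {T : ℕ → ℕ → ℤ} :
    IsGT n lam T ↔ IsPattern n (fun j => lam j + (n - 1 - j)) T := by
  refine and_congr_right fun _ => and_congr_left fun _ => ?_
  rw [Fin.forall_iff]
  refine forall₂_congr fun j hj => ?_
  dsimp only
  rw [show ((lam j + (n - 1 - j) : ℕ) : ℤ) = lam j + n - 1 - j by omega]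

theorem Zice_eq_ice {n : ℕ} (hn : 1 ≤ n) {lam : ℕ → ℕ}
    (hμ : StrictAnti fun j : Fin n => lam j + (n - 1 - j)) (z t : ℕ → ℂ) :
    Zice n lam z t = ice n (fun j => lam j + (n - 1 - j)) z t := by
  rw [← sum_patternWeight hμ, Zice]
  simp only [← patternWeight_eq hn, isGT_iff_isPattern, ← mem_patterns hμ]
  exact finsum_mem_finset_eq_sum _ _

end Patterns

theorem stmt19 (n : ℕ) (hn : 1 ≤ n) (lam : ℕ → ℕ)
    (hlam : ∀ i j : ℕ, i ≤ j → j < n → lam j ≤ lam i) :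
    ∃ Q : MvPolynomial (Fin n) ℂ, Q.IsSymmetric ∧
      ∀ z t : ℕ → ℂ,
        Zice n lam z t
          = MvPolynomial.eval (fun i : Fin n => z i) Q *
              ∏ i ∈ Finset.range n, ∏ j ∈ Finset.Ico (i + 1) n, (t i * z j + z i) := by
  have hμ : StrictAnti fun j : Fin n => lam j + (n - 1 - j) := fun i j hij => by
    have := hlam i j (Fin.lt_def.1 hij).le j.2
    have := Fin.lt_def.1 hij
    dsimp only
    omega
  obtain ⟨Q, hQ, h⟩ := exists_symmetric_ice_eq hμ
  exact ⟨Q, hQ, fun z t => (Zice_eq_ice hn hμ z t).trans (h z t)⟩
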